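/- arXiv:2509.23800 — 2 statements merged into one kernel-verified Lean document; each statement's English description precedes it below -/
import Mathlib

section
/- Let ξ = [ε₁, …, ε_K] ∈ ℝ^{D×K} be a matrix with full column rank K, and let 𝒯_→ : ℝ^D → ℝ^D and 𝒯_← : ℝ^D → ℝ^D satisfy 𝒯_→(𝒯_←(ε)) = α(ε)·ε for all ε ∈ ℝ^D, where α(ε) > 0. Then the map l(w) = 𝒯_←(ξw) is injective on the positive orthant S₊^{K−1} of the unit sphere of ℝ^K: if w₁, w₂ ∈ S₊^{K−1} and 𝒯_←(ξw₁) = 𝒯_←(ξw₂), then w₁ = w₂. -/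
open Finset

/-- **Injectivity of the `l` map on the positive orthant of the unit sphere.**
If `ξ ∈ ℝ^{D×K}` has full column rank and `𝒯_→ (𝒯_← ε) = α ε • ε` with
`α ε > 0`, then `w ↦ 𝒯_← (ξ w)` is injective on
`S₊^{K-1} = {w : ‖w‖₂ = 1, wᵢ ≥ 0}`. -/
theorem stmt2 {D K : ℕ} (ξ : Matrix (Fin D) (Fin K) ℝ)
    (hrank : ξ.rank = K)
    (Tto Tfrom : (Fin D → ℝ) → (Fin D → ℝ))
    (α : (Fin D → ℝ) → ℝ)
    (hα : ∀ ε, 0 < α ε)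
    (hT : ∀ ε, Tto (Tfrom ε) = α ε • ε)
    (w₁ w₂ : Fin K → ℝ)
    (hw₁_norm : Real.sqrt (∑ k, w₁ k ^ 2) = 1) (hw₁_pos : ∀ k, 0 ≤ w₁ k)
    (hw₂_norm : Real.sqrt (∑ k, w₂ k ^ 2) = 1) (hw₂_pos : ∀ k, 0 ≤ w₂ k)
    (heq : Tfrom (ξ.mulVec w₁) = Tfrom (ξ.mulVec w₂)) :
    w₁ = w₂ := by
  have hinj : Function.Injective ξ.mulVec := by
    rw [Matrix.mulVec_injective_iff, linearIndependent_iff_card_eq_finrank_span,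
      Set.finrank, ← Matrix.rank_eq_finrank_span_cols, hrank, Fintype.card_fin]
  have h := hT (ξ.mulVec w₁)
  rw [heq, hT, ← Matrix.mulVec_smul, ← Matrix.mulVec_smul] at h
  have h2 := hinj h
  have ha := hα (ξ.mulVec w₁)
  have hb := hα (ξ.mulVec w₂)
  generalize α (ξ.mulVec w₁) = a at *
  generalize α (ξ.mulVec w₂) = b at *
  rw [Real.sqrt_eq_one] at hw₁_norm hw₂_norm
  have hk : ∀ k, b * w₂ k = a * w₁ k := fun k => by
    simpa using congrFun h2 k
  have hs : b ^ 2 = a ^ 2 := by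
    calc b ^ 2 = b ^ 2 * ∑ k, w₂ k ^ 2 := by rw [hw₂_norm, mul_one]
      _ = ∑ k, (b * w₂ k) ^ 2 := by simp only [mul_pow, Finset.mul_sum]
      _ = ∑ k, (a * w₁ k) ^ 2 := by simp only [hk]
      _ = a ^ 2 * ∑ k, w₁ k ^ 2 := by simp only [mul_pow, Finset.mul_sum]
      _ = a ^ 2 := by rw [hw₁_norm, mul_one]
  have hab : b = a := (pow_left_inj₀ hb.le ha.le two_ne_zero).1 hs
  funext k
  have := hk k
  rw [hab] at this
  exact (mul_left_cancel₀ ha.ne' this).symm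
end

section
/- Fix K ≥ 2. The stick-breaking map, sending v ∈ (0,1)^{K−1} to z ∈ ℝ^K via z₁ = v₁, z_k = v_k ∏_{i=1}^{k−1}(1 − vᵢ) for 2 ≤ k ≤ K−1, and z_K = ∏_{i=1}^{K−1}(1 − vᵢ), is a bijection from (0,1)^{K−1} onto the open simplex { z ∈ ℝ^K : z_k > 0 for all k, Σ_k z_k = 1 }, with inverse given by v_k = z_k / s_k where s_k = Σ_{j=k}^{K} z_j. -/
open Finset

/-- The stick-breaking map: `z₁ = v₁`, `z_k = v_k ∏_{i<k} (1 - vᵢ)` for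
`k < K - 1` (0-indexed), and `z_K = ∏_{i<K-1} (1 - vᵢ)`. -/
def stickBreak {K : ℕ} (v : Fin (K - 1) → ℝ) : Fin K → ℝ :=
  fun k =>
    if h : (k : ℕ) < K - 1 then
      v ⟨k, h⟩ *
        ∏ i ∈ Finset.univ.filter fun i : Fin (K - 1) => (i : ℕ) < (k : ℕ),
          (1 - v i)
    else
      ∏ i : Fin (K - 1), (1 - v i)

def sbP {n : ℕ} (v : Fin n → ℝ) (m : ℕ) : ℝ :=
  ∏ i ∈ Finset.univ.filter (fun i : Fin n => (i : ℕ) < m), (1 - v i)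

def sbS {n : ℕ} (z : Fin n → ℝ) (m : ℕ) : ℝ :=
  ∑ j ∈ Finset.univ.filter (fun j : Fin n => m ≤ (j : ℕ)), z j

lemma sbP_zero {n : ℕ} (v : Fin n → ℝ) : sbP v 0 = 1 := by simp [sbP]

lemma sbP_succ {n : ℕ} (v : Fin n → ℝ) (m : ℕ) (h : m < n) :
    sbP v (m + 1) = (1 - v ⟨m, h⟩) * sbP v m := by
  unfold sbP
  rw [← Finset.prod_insert (f := fun i => 1 - v i) (by simp)]
  congr 1
  ext i
  simp [Fin.ext_iff]
  omega

lemma sbS_succ {n : ℕ} (z : Fin n → ℝ) (m : ℕ) (h : m < n) :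
    sbS z m = z ⟨m, h⟩ + sbS z (m + 1) := by
  unfold sbS
  rw [← Finset.sum_insert (by simp)]
  congr 1
  ext i
  simp [Fin.ext_iff]
  omega

lemma sbS_top {n : ℕ} (z : Fin n → ℝ) : sbS z n = 0 := by
  unfold sbS
  apply Finset.sum_eq_zero
  intro i hi
  have := i.2
  simp at hi
  omega

lemma sbS_zero {n : ℕ} (z : Fin n → ℝ) : sbS z 0 = ∑ k, z k := by simp [sbS]

lemma sb_lt {n : ℕ} (v : Fin n → ℝ) (m : ℕ) (h : m < n) (h' : m < n + 1) :
    stickBreak (K := n + 1) v ⟨m, h'⟩ = v ⟨m, h⟩ * sbP v m := by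
  unfold stickBreak
  exact dif_pos (show m < n + 1 - 1 from h)

lemma sb_last {n : ℕ} (v : Fin n → ℝ) (h' : n < n + 1) :
    stickBreak (K := n + 1) v ⟨n, h'⟩ = sbP v n := by
  unfold stickBreak
  refine (dif_neg (show ¬ n < n + 1 - 1 by simp)).trans ?_
  simp [sbP]

lemma sbS_sb {n : ℕ} (v : Fin n → ℝ) (d : ℕ) : ∀ m, m + d = n →
    sbS (stickBreak (K := n + 1) v) m = sbP v m := by
  induction d with
  | zero =>
    rintro m rfl
    rw [sbS_succ _ _ (by omega), sbS_top]
    simpa using sb_last v (by omega)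
  | succ d ih =>
    intro m hm
    rw [sbS_succ _ _ (by omega), ih (m + 1) (by omega), sbP_succ _ _ (by omega),
      sb_lt _ _ (by omega)]
    ring

lemma sbP_pos {n : ℕ} (v : Fin n → ℝ) (hv : ∀ i, v i ∈ Set.Ioo (0 : ℝ) 1) (m : ℕ) :
    0 < sbP v m :=
  Finset.prod_pos fun i _ => sub_pos.2 (hv i).2

lemma sbS_pos {n : ℕ} (z : Fin n → ℝ) (hz : ∀ i, 0 < z i) (m : ℕ) (h : m < n) :
    0 < sbS z m :=
  Finset.sum_pos (fun i _ => hz i) ⟨⟨m, h⟩, by simp⟩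

lemma sb_inv {n : ℕ} (v : Fin n → ℝ) (hv : ∀ i, v i ∈ Set.Ioo (0 : ℝ) 1) (k : Fin n) :
    v k = stickBreak (K := n + 1) v ⟨k, by omega⟩ / sbS (stickBreak (K := n + 1) v) k := by
  rw [sbS_sb v (n - k) k (by omega), sb_lt v k k.2,
    mul_div_cancel_right₀ _ (sbP_pos v hv k).ne']

lemma sbP_inv {n : ℕ} (z : Fin (n + 1) → ℝ) (hz : ∀ i, 0 < z i) (h1 : ∑ k, z k = 1) (m : ℕ)
    (hm : m ≤ n) : sbP (fun k : Fin n => z k.castSucc / sbS z k) m = sbS z m := by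
  induction m with
  | zero => rw [sbP_zero, sbS_zero, h1]
  | succ m ih =>
    have hp := sbS_pos z hz m (by omega)
    have hs := sbS_succ z m (by omega)
    rw [sbP_succ _ _ (by omega), ih (by omega)]
    simp only [Fin.castSucc_mk]
    rw [sub_mul, div_mul_cancel₀ _ hp.ne']
    linarith

/-- **The stick-breaking map is a bijection from the open cube onto the open
simplex**, with inverse `v_k = z_k / s_k` where `s_k = ∑_{j ≥ k} z_j`. -/
theorem stmt15 {K : ℕ} (hK : 2 ≤ K) :
    Set.BijOn (stickBreak (K := K))
      {v | ∀ i, v i ∈ Set.Ioo (0 : ℝ) 1}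
      {z : Fin K → ℝ | (∀ k, 0 < z k) ∧ (∑ k, z k) = 1} ∧
    ∀ v : Fin (K - 1) → ℝ, (∀ i, v i ∈ Set.Ioo (0 : ℝ) 1) →
      ∀ k : Fin (K - 1),
        v k = stickBreak v (Fin.castLE (Nat.sub_le K 1) k) /
          ∑ j ∈ Finset.univ.filter (fun j : Fin K => (k : ℕ) ≤ (j : ℕ)),
            stickBreak v j := by
  obtain ⟨n, rfl⟩ : ∃ n, K = n + 1 := ⟨K - 1, by omega⟩
  refine ⟨⟨?_, ?_, ?_⟩, fun v hv k => sb_inv (n := n) v hv k⟩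
  · intro v hv
    refine ⟨?_, ?_⟩
    · rintro ⟨k, hk⟩
      rcases Nat.lt_or_ge k n with h | h
      · rw [sb_lt (n := n) v k h]
        exact mul_pos (hv _).1 (sbP_pos (n := n) v hv k)
      · obtain rfl : k = n := by omega
        rw [sb_last (n := k) v]
        exact sbP_pos (n := k) v hv k
    · rw [← sbS_zero, sbS_sb (n := n) v n 0 (by omega), sbP_zero]
  · intro v hv w hw h
    funext k
    refine (sb_inv (n := n) v hv k).trans (Eq.trans ?_ (sb_inv (n := n) w hw k).symm)
    rw [h]
  · rintro z ⟨hz, h1⟩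
    refine ⟨fun k : Fin n => z k.castSucc / sbS z k, ?_, ?_⟩
    · rintro ⟨k, hk⟩
      replace hk : k < n := hk
      have hp := sbS_pos z hz k (by omega)
      have hp' := sbS_pos z hz (k + 1) (by omega)
      have hs := sbS_succ z k (by omega)
      refine ⟨div_pos (hz _) hp, (div_lt_one hp).2 ?_⟩
      change z ⟨k, _⟩ < sbS z k
      linarith
    · funext ⟨k, hk⟩
      rcases Nat.lt_or_ge k n with h | h
      · rw [sb_lt (n := n) _ k h, sbP_inv z hz h1 k h.le]
        exact div_mul_cancel₀ _ (sbS_pos z hz k hk).ne'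
      · obtain rfl : k = n := by omega
        rw [sb_last (n := k), sbP_inv z hz h1 k le_rfl, sbS_succ z k hk, sbS_top, add_zero]
end
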